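/- arXiv:1109.5950 — 3 statements merged into one kernel-verified Lean document; each statement's English description precedes it below -/
import Mathlib

section
/- Let V, W, U be normed complex vector spaces and b : V × W → U a bilinear map with ‖b(v,w)‖ ≤ c‖v‖‖w‖ for some c > 0 and all v, w. Let m, m', ρ, ρ' ∈ ℝ, F ∈ S^{m,ρ}(ℝ^{n}, V), G ∈ S^{m',ρ'}(ℝ^{n'}, W), and define H : ℝ^{n+n'} → U by H(x,y) := b(F(x), G(y)). Then for any m'' ≥ max{m, m', m+m'} and any ρ'' ≤ min{0, ρ, ρ'}, H belongs to S^{m'',ρ''}(ℝ^{n+n'}, U), and for all multiindices ν ∈ ℕ^n, ν' ∈ ℕ^{n'} one has ‖H‖^{m'',ρ''}_{ν⊕ν'} ≤ c ‖F‖^{m,ρ}_ν ‖G‖^{m',ρ'}_{ν'}, where ν⊕ν' is the concatenated multiindex. -/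
open Filter MeasureTheory

noncomputable def pder {n : ℕ} {V : Type*} [NormedAddCommGroup V] [NormedSpace ℝ V]
    (i : Fin n) (f : (Fin n → ℝ) → V) : (Fin n → ℝ) → V :=
  fun x => fderiv ℝ f x (Pi.single i 1)

noncomputable def mder {n : ℕ} {V : Type*} [NormedAddCommGroup V] [NormedSpace ℝ V]
    (μ : Fin n → ℕ) (f : (Fin n → ℝ) → V) : (Fin n → ℝ) → V :=
  (List.finRange n).foldr (fun i g => (pder i)^[μ i] g) f

def mOrder {n : ℕ} (μ : Fin n → ℕ) : ℕ := ∑ i, μ i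

noncomputable def symWt {n : ℕ} (m ρ : ℝ) (μ : Fin n → ℕ) (x : Fin n → ℝ) : ℝ :=
  (1 + ‖x‖ ^ 2) ^ (-(m - ρ * (mOrder μ : ℝ)) / 2)

noncomputable def symNorm {n : ℕ} {V : Type*} [NormedAddCommGroup V] [NormedSpace ℝ V]
    (m ρ : ℝ) (μ : Fin n → ℕ) (F : (Fin n → ℝ) → V) : ℝ :=
  ⨆ x : Fin n → ℝ, symWt m ρ μ x * ‖mder μ F x‖

def IsSymbol {n : ℕ} {V : Type*} [NormedAddCommGroup V] [NormedSpace ℝ V]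
    (m ρ : ℝ) (F : (Fin n → ℝ) → V) : Prop :=
  ContDiff ℝ (⊤ : ℕ∞) F ∧ ∀ μ : Fin n → ℕ, ∃ C : ℝ, ∀ x, symWt m ρ μ x * ‖mder μ F x‖ ≤ C

/-- The bilinear exterior combination of two functions of separate groups of variables. -/
noncomputable def exteriorBilin {n n' : ℕ} {V W U : Type*}
    [NormedAddCommGroup V] [NormedSpace ℝ V] [NormedAddCommGroup W] [NormedSpace ℝ W]
    [NormedAddCommGroup U] [NormedSpace ℝ U] (B : V →L[ℝ] W →L[ℝ] U)
    (F : (Fin n → ℝ) → V) (G : (Fin n' → ℝ) → W) : (Fin (n + n') → ℝ) → U :=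
  fun z => B (F (fun i => z (Fin.castAdd n' i))) (G (fun j => z (Fin.natAdd n j)))

section Derivatives

variable {n n' : ℕ} {V W U : Type*}
  [NormedAddCommGroup V] [NormedSpace ℝ V] [NormedAddCommGroup W] [NormedSpace ℝ W]
  [NormedAddCommGroup U] [NormedSpace ℝ U]

lemma contDiff_pder {f : (Fin n → ℝ) → V} (hf : ContDiff ℝ (⊤ : ℕ∞) f) (i : Fin n) :
    ContDiff ℝ (⊤ : ℕ∞) (pder i f) :=
  (hf.fderiv_right (m := (⊤ : ℕ∞)) (by simp)).clm_apply contDiff_const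

lemma contDiff_iterate_pder {f : (Fin n → ℝ) → V} (hf : ContDiff ℝ (⊤ : ℕ∞) f)
    (i : Fin n) (k : ℕ) : ContDiff ℝ (⊤ : ℕ∞) ((pder i)^[k] f) := by
  induction k with
  | zero => exact hf
  | succ k ih => rw [Function.iterate_succ_apply']; exact contDiff_pder ih i

lemma contDiff_foldr_pder {f : (Fin n → ℝ) → V} (hf : ContDiff ℝ (⊤ : ℕ∞) f)
    (μ : Fin n → ℕ) (l : List (Fin n)) :
    ContDiff ℝ (⊤ : ℕ∞) (l.foldr (fun i g => (pder i)^[μ i] g) f) := by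
  induction l with
  | nil => exact hf
  | cons i l ih => exact contDiff_iterate_pder ih i _

lemma contDiff_mder {f : (Fin n → ℝ) → V} (hf : ContDiff ℝ (⊤ : ℕ∞) f) (μ : Fin n → ℕ) :
    ContDiff ℝ (⊤ : ℕ∞) (mder μ f) :=
  contDiff_foldr_pder hf μ _

variable (B : V →L[ℝ] W →L[ℝ] U) {F : (Fin n → ℝ) → V} {G : (Fin n' → ℝ) → W}

lemma contDiff_exteriorBilin (hF : ContDiff ℝ (⊤ : ℕ∞) F) (hG : ContDiff ℝ (⊤ : ℕ∞) G) :
    ContDiff ℝ (⊤ : ℕ∞) (exteriorBilin B F G) := by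
  have h₁ : ContDiff ℝ (⊤ : ℕ∞) fun z : Fin (n + n') → ℝ => F fun i => z (Fin.castAdd n' i) :=
    hF.comp (by fun_prop)
  have h₂ : ContDiff ℝ (⊤ : ℕ∞) fun z : Fin (n + n') → ℝ => G fun j => z (Fin.natAdd n j) :=
    hG.comp (by fun_prop)
  exact (B.contDiff.comp h₁).clm_apply h₂

lemma fderiv_exteriorBilin (hF : Differentiable ℝ F) (hG : Differentiable ℝ G)
    (z v : Fin (n + n') → ℝ) :
    fderiv ℝ (exteriorBilin B F G) z v =
      B (F fun i => z (Fin.castAdd n' i))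
        (fderiv ℝ G (fun j => z (Fin.natAdd n j)) fun j => v (Fin.natAdd n j)) +
      B (fderiv ℝ F (fun i => z (Fin.castAdd n' i)) fun i => v (Fin.castAdd n' i))
        (G fun j => z (Fin.natAdd n j)) := by
  let p : (Fin (n + n') → ℝ) →L[ℝ] (Fin n → ℝ) :=
    ContinuousLinearMap.pi fun i => ContinuousLinearMap.proj (Fin.castAdd n' i)
  let q : (Fin (n + n') → ℝ) →L[ℝ] (Fin n' → ℝ) :=
    ContinuousLinearMap.pi fun j => ContinuousLinearMap.proj (Fin.natAdd n j)
  have h := B.hasFDerivAt_of_bilinear ((hF (p z)).hasFDerivAt.comp z p.hasFDerivAt)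
    ((hG (q z)).hasFDerivAt.comp z q.hasFDerivAt)
  exact congrArg (fun L => L v) h.fderiv

lemma pder_castAdd_exteriorBilin (hF : Differentiable ℝ F) (hG : Differentiable ℝ G)
    (i : Fin n) :
    pder (Fin.castAdd n' i) (exteriorBilin B F G) = exteriorBilin B (pder i F) G := by
  funext z
  have h₁ : (fun k => (Pi.single (Fin.castAdd n' i) 1 : Fin (n + n') → ℝ) (Fin.castAdd n' k)) =
      Pi.single i 1 := by
    funext k
    simp [Pi.single_apply]
  have h₂ : (fun j => (Pi.single (Fin.castAdd n' i) 1 : Fin (n + n') → ℝ) (Fin.natAdd n j)) =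
      0 := by
    funext j
    simp [Pi.single_apply, Fin.ext_iff]
    omega
  rw [pder, fderiv_exteriorBilin B hF hG, h₁, h₂]
  simp [exteriorBilin, pder]

lemma pder_natAdd_exteriorBilin (hF : Differentiable ℝ F) (hG : Differentiable ℝ G)
    (j : Fin n') :
    pder (Fin.natAdd n j) (exteriorBilin B F G) = exteriorBilin B F (pder j G) := by
  funext z
  have h₁ : (fun k => (Pi.single (Fin.natAdd n j) 1 : Fin (n + n') → ℝ) (Fin.natAdd n k)) =
      Pi.single j 1 := by
    funext k
    simp [Pi.single_apply]
  have h₂ : (fun i => (Pi.single (Fin.natAdd n j) 1 : Fin (n + n') → ℝ) (Fin.castAdd n' i)) =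
      0 := by
    funext i
    simp [Pi.single_apply, Fin.ext_iff]
    omega
  rw [pder, fderiv_exteriorBilin B hF hG, h₁, h₂]
  simp [exteriorBilin, pder]

lemma iterate_pder_castAdd_exteriorBilin (hF : ContDiff ℝ (⊤ : ℕ∞) F)
    (hG : ContDiff ℝ (⊤ : ℕ∞) G) (i : Fin n) (k : ℕ) :
    (pder (Fin.castAdd n' i))^[k] (exteriorBilin B F G) =
      exteriorBilin B ((pder i)^[k] F) G := by
  induction k with
  | zero => rfl
  | succ k ih =>
    rw [Function.iterate_succ_apply', Function.iterate_succ_apply', ih]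
    exact pder_castAdd_exteriorBilin B
      ((contDiff_iterate_pder hF i k).differentiable (by simp)) (hG.differentiable (by simp)) i

lemma iterate_pder_natAdd_exteriorBilin (hF : ContDiff ℝ (⊤ : ℕ∞) F)
    (hG : ContDiff ℝ (⊤ : ℕ∞) G) (j : Fin n') (k : ℕ) :
    (pder (Fin.natAdd n j))^[k] (exteriorBilin B F G) =
      exteriorBilin B F ((pder j)^[k] G) := by
  induction k with
  | zero => rfl
  | succ k ih =>
    rw [Function.iterate_succ_apply', Function.iterate_succ_apply', ih]
    exact pder_natAdd_exteriorBilin B (hF.differentiable (by simp))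
      ((contDiff_iterate_pder hG j k).differentiable (by simp)) j

lemma finRange_add (n n' : ℕ) :
    List.finRange (n + n') =
      (List.finRange n).map (Fin.castAdd n') ++ (List.finRange n').map (Fin.natAdd n) := by
  apply List.ext_getElem
  · simp
  · intro k h₁ h₂
    rw [List.getElem_append]
    split_ifs with h
    · simp
    · simp at h
      simp [Fin.ext_iff]
      omega

lemma mder_append_exteriorBilin (hF : ContDiff ℝ (⊤ : ℕ∞) F) (hG : ContDiff ℝ (⊤ : ℕ∞) G)
    (ν : Fin n → ℕ) (ν' : Fin n' → ℕ) :
    mder (Fin.append ν ν') (exteriorBilin B F G) =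
      exteriorBilin B (mder ν F) (mder ν' G) := by
  have hG' : ∀ l : List (Fin n'),
      l.foldr (fun j g => (pder (Fin.natAdd n j))^[ν' j] g) (exteriorBilin B F G) =
        exteriorBilin B F (l.foldr (fun j g => (pder j)^[ν' j] g) G) := by
    intro l
    induction l with
    | nil => rfl
    | cons j l ih =>
      rw [List.foldr_cons, ih, List.foldr_cons]
      exact iterate_pder_natAdd_exteriorBilin B hF (contDiff_foldr_pder hG ν' l) j _
  have hF' : ∀ l : List (Fin n),
      l.foldr (fun i g => (pder (Fin.castAdd n' i))^[ν i] g) (exteriorBilin B F (mder ν' G)) =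
        exteriorBilin B (l.foldr (fun i g => (pder i)^[ν i] g) F) (mder ν' G) := by
    intro l
    induction l with
    | nil => rfl
    | cons i l ih =>
      rw [List.foldr_cons, ih, List.foldr_cons]
      exact iterate_pder_castAdd_exteriorBilin B (contDiff_foldr_pder hF ν l)
        (contDiff_mder hG ν') i _
  rw [mder, finRange_add, List.foldr_append, List.foldr_map, List.foldr_map]
  simp only [Fin.append_left, Fin.append_right]
  rw [hG']
  exact hF' _

end Derivatives

section Weights

lemma mOrder_append {n n' : ℕ} (ν : Fin n → ℕ) (ν' : Fin n' → ℕ) :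
    mOrder (Fin.append ν ν') = mOrder ν + mOrder ν' := by
  simp [mOrder, Fin.sum_univ_add]

lemma norm_eq_max_castAdd_natAdd {n n' : ℕ} (z : Fin (n + n') → ℝ) :
    ‖z‖ = max ‖fun i => z (Fin.castAdd n' i)‖ ‖fun j => z (Fin.natAdd n j)‖ := by
  apply le_antisymm
  · refine (pi_norm_le_iff_of_nonneg (by positivity)).2 fun k => ?_
    induction k using Fin.addCases with
    | left i => exact le_max_of_le_left (norm_le_pi_norm (fun i => z (Fin.castAdd n' i)) i)
    | right j => exact le_max_of_le_right (norm_le_pi_norm (fun j => z (Fin.natAdd n j)) j)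
  · exact max_le ((pi_norm_le_iff_of_nonneg (norm_nonneg z)).2 fun i => norm_le_pi_norm z _)
      ((pi_norm_le_iff_of_nonneg (norm_nonneg z)).2 fun j => norm_le_pi_norm z _)

lemma rpow_le_rpow_mul_rpow {A B s t r : ℝ} (hB : 1 ≤ B) (hBA : B ≤ A)
    (hs : r ≤ s) (hst : r ≤ s + t) : A ^ r ≤ A ^ s * B ^ t := by
  have hB0 : 0 < B := by linarith
  have hA : 1 ≤ A := hB.trans hBA
  have hA0 : 0 < A := by linarith
  rcases le_total 0 t with ht | ht
  · calc A ^ r ≤ A ^ s := Real.rpow_le_rpow_of_exponent_le hA hs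
      _ ≤ A ^ s * B ^ t := le_mul_of_one_le_right (by positivity) (Real.one_le_rpow hB ht)
  · calc A ^ r ≤ A ^ (s + t) := Real.rpow_le_rpow_of_exponent_le hA hst
      _ = A ^ s * A ^ t := Real.rpow_add hA0 s t
      _ ≤ A ^ s * B ^ t := by
        exact mul_le_mul_of_nonneg_left (Real.rpow_le_rpow_of_nonpos hB0 hBA ht) (by positivity)

lemma symWt_nonneg {n : ℕ} (m ρ : ℝ) (μ : Fin n → ℕ) (x : Fin n → ℝ) : 0 ≤ symWt m ρ μ x := by
  unfold symWt
  positivity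

lemma symWt_append_le {n n' : ℕ} {m m' ρ ρ' m'' ρ'' : ℝ}
    (hm : max m (max m' (m + m')) ≤ m'') (hρ : ρ'' ≤ min 0 (min ρ ρ'))
    (ν : Fin n → ℕ) (ν' : Fin n' → ℕ) (z : Fin (n + n') → ℝ) :
    symWt m'' ρ'' (Fin.append ν ν') z ≤
      symWt m ρ ν (fun i => z (Fin.castAdd n' i)) *
        symWt m' ρ' ν' (fun j => z (Fin.natAdd n j)) := by
  simp only [max_le_iff, le_min_iff] at hm hρ
  obtain ⟨hm₁, hm₂, hm₃⟩ := hm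
  obtain ⟨hρ₀, hρ₁, hρ₂⟩ := hρ
  have hk : (0 : ℝ) ≤ mOrder ν := Nat.cast_nonneg _
  have hk' : (0 : ℝ) ≤ mOrder ν' := Nat.cast_nonneg _
  have h₁ := mul_le_mul_of_nonneg_right hρ₁ hk
  have h₂ := mul_le_mul_of_nonneg_right hρ₂ hk'
  have h₃ := mul_nonpos_of_nonpos_of_nonneg hρ₀ hk
  have h₄ := mul_nonpos_of_nonpos_of_nonneg hρ₀ hk'
  simp only [symWt, mOrder_append, Nat.cast_add, norm_eq_max_castAdd_natAdd z]
  set a := ‖fun i => z (Fin.castAdd n' i)‖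
  set b := ‖fun j => z (Fin.natAdd n j)‖
  have ha : 0 ≤ a := norm_nonneg _
  have hb : 0 ≤ b := norm_nonneg _
  rcases le_total b a with h | h
  · rw [max_eq_left h]
    exact rpow_le_rpow_mul_rpow (by nlinarith) (by gcongr) (by linarith) (by linarith)
  · rw [max_eq_right h, mul_comm (_ ^ _)]
    exact rpow_le_rpow_mul_rpow (by nlinarith) (by gcongr) (by linarith) (by linarith)

lemma symNorm_nonneg {n : ℕ} {V : Type*} [NormedAddCommGroup V] [NormedSpace ℝ V]
    (m ρ : ℝ) (μ : Fin n → ℕ) (F : (Fin n → ℝ) → V) : 0 ≤ symNorm m ρ μ F :=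
  Real.iSup_nonneg fun x => mul_nonneg (symWt_nonneg m ρ μ x) (norm_nonneg _)

lemma IsSymbol.le_symNorm {n : ℕ} {V : Type*} [NormedAddCommGroup V] [NormedSpace ℝ V]
    {m ρ : ℝ} {F : (Fin n → ℝ) → V} (hF : IsSymbol m ρ F) (μ : Fin n → ℕ) (x : Fin n → ℝ) :
    symWt m ρ μ x * ‖mder μ F x‖ ≤ symNorm m ρ μ F := by
  obtain ⟨C, hC⟩ := hF.2 μ
  exact le_ciSup (f := fun x => symWt m ρ μ x * ‖mder μ F x‖) ⟨C, Set.forall_mem_range.2 hC⟩ x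

end Weights

lemma symWt_mul_norm_mder_exteriorBilin_le {n n' : ℕ} {V W U : Type*}
    [NormedAddCommGroup V] [NormedSpace ℝ V] [NormedAddCommGroup W] [NormedSpace ℝ W]
    [NormedAddCommGroup U] [NormedSpace ℝ U] (B : V →L[ℝ] W →L[ℝ] U) {c : ℝ} (hc : 0 ≤ c)
    (hB : ∀ v w, ‖B v w‖ ≤ c * ‖v‖ * ‖w‖) {m m' ρ ρ' m'' ρ'' : ℝ}
    {F : (Fin n → ℝ) → V} {G : (Fin n' → ℝ) → W}
    (hF : IsSymbol m ρ F) (hG : IsSymbol m' ρ' G)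
    (hm : max m (max m' (m + m')) ≤ m'') (hρ : ρ'' ≤ min 0 (min ρ ρ'))
    (ν : Fin n → ℕ) (ν' : Fin n' → ℕ) (z : Fin (n + n') → ℝ) :
    symWt m'' ρ'' (Fin.append ν ν') z * ‖mder (Fin.append ν ν') (exteriorBilin B F G) z‖ ≤
      c * symNorm m ρ ν F * symNorm m' ρ' ν' G := by
  rw [mder_append_exteriorBilin B hF.1 hG.1]
  set x : Fin n → ℝ := fun i => z (Fin.castAdd n' i)
  set y : Fin n' → ℝ := fun j => z (Fin.natAdd n j)
  have hx := symWt_nonneg m ρ ν x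
  have hy := symWt_nonneg m' ρ' ν' y
  calc symWt m'' ρ'' (Fin.append ν ν') z * ‖exteriorBilin B (mder ν F) (mder ν' G) z‖
      ≤ (symWt m ρ ν x * symWt m' ρ' ν' y) * (c * ‖mder ν F x‖ * ‖mder ν' G y‖) :=
        mul_le_mul (symWt_append_le hm hρ ν ν' z) (hB _ _) (norm_nonneg _) (mul_nonneg hx hy)
    _ = c * (symWt m ρ ν x * ‖mder ν F x‖) * (symWt m' ρ' ν' y * ‖mder ν' G y‖) := by ring
    _ ≤ c * symNorm m ρ ν F * symNorm m' ρ' ν' G :=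
        mul_le_mul (mul_le_mul_of_nonneg_left (hF.le_symNorm ν x) hc) (hG.le_symNorm ν' y)
          (mul_nonneg hy (norm_nonneg _)) (mul_nonneg hc (symNorm_nonneg m ρ ν F))

theorem statement2 {n n' : ℕ} {V W U : Type*}
    [NormedAddCommGroup V] [NormedSpace ℝ V] [NormedSpace ℂ V] [IsScalarTower ℝ ℂ V]
    [NormedAddCommGroup W] [NormedSpace ℝ W] [NormedSpace ℂ W] [IsScalarTower ℝ ℂ W]
    [NormedAddCommGroup U] [NormedSpace ℝ U] [NormedSpace ℂ U] [IsScalarTower ℝ ℂ U]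
    (b : V →L[ℂ] W →L[ℂ] U) (c : ℝ) (hc : 0 < c)
    (hb : ∀ (v : V) (w : W), ‖b v w‖ ≤ c * ‖v‖ * ‖w‖)
    (m m' ρ ρ' : ℝ) (F : (Fin n → ℝ) → V) (G : (Fin n' → ℝ) → W)
    (hFs : IsSymbol m ρ F) (hGs : IsSymbol m' ρ' G)
    (m'' ρ'' : ℝ) (hm'' : max m (max m' (m + m')) ≤ m'') (hρ'' : ρ'' ≤ min 0 (min ρ ρ')) :
    IsSymbol m'' ρ'' (fun z : Fin (n + n') → ℝ =>
      b (F (fun i => z (Fin.castAdd n' i))) (G (fun j => z (Fin.natAdd n j)))) ∧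
    ∀ (ν : Fin n → ℕ) (ν' : Fin n' → ℕ),
      symNorm m'' ρ'' (Fin.append ν ν')
        (fun z : Fin (n + n') → ℝ =>
          b (F (fun i => z (Fin.castAdd n' i))) (G (fun j => z (Fin.natAdd n j)))) ≤
        c * symNorm m ρ ν F * symNorm m' ρ' ν' G := by
  have key := symWt_mul_norm_mder_exteriorBilin_le (b.bilinearRestrictScalars ℝ) hc.le hb
    hFs hGs hm'' hρ''
  refine ⟨⟨contDiff_exteriorBilin (b.bilinearRestrictScalars ℝ) hFs.1 hGs.1, fun μ => ?_⟩,
    fun ν ν' => ciSup_le (key ν ν')⟩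
  rw [← Fin.append_castAdd_natAdd (f := μ)]
  exact ⟨_, key _ _⟩
end

section
/- Let V be a normed complex vector space and let χ : ℝ^n → ℝ be a compactly supported smooth function with χ = 1 on the closed ball of radius r > 0 around 0; set χ_ε(x) := χ(εx) for ε > 0. Let m, ρ ∈ ℝ and F ∈ S^{m,ρ}(ℝ^n, V). Then for every m' > m, every ρ' ≤ min(1, ρ), and every multiindex μ ∈ ℕ^n, the symbol seminorm ‖χ_ε F − F‖^{m',ρ'}_μ tends to 0 as ε → 0⁺; i.e. χ_ε F converges to F in the S^{m',ρ'}-topology. -/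
open Filter MeasureTheory

open scoped ContDiff

section WordDerivative

variable {n : ℕ} {V : Type*} [NormedAddCommGroup V] [NormedSpace ℝ V]

/-- The iterated partial derivative along a word of coordinate directions. -/
noncomputable def wordDer (L : List (Fin n)) (f : (Fin n → ℝ) → V) : (Fin n → ℝ) → V :=
  L.foldr pder f

lemma wordDer_append (L L' : List (Fin n)) (f : (Fin n → ℝ) → V) :
    wordDer (L ++ L') f = wordDer L (wordDer L' f) :=
  List.foldr_append

lemma wordDer_concat (L : List (Fin n)) (i : Fin n) (f : (Fin n → ℝ) → V) :
    wordDer (L ++ [i]) f = wordDer L (pder i f) :=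
  wordDer_append L [i] f

lemma wordDer_replicate (k : ℕ) (i : Fin n) (f : (Fin n → ℝ) → V) :
    wordDer (List.replicate k i) f = (pder i)^[k] f := by
  induction k with
  | zero => rfl
  | succ k ih =>
    rw [Function.iterate_succ_apply', ← ih]
    rfl

/-- The nondecreasing word in which the letter `i` occurs `μ i` times. -/
def sortedWord (μ : Fin n → ℕ) : List (Fin n) :=
  (List.finRange n).flatMap fun i => List.replicate (μ i) i

lemma mder_eq_wordDer (μ : Fin n → ℕ) (f : (Fin n → ℝ) → V) :
    mder μ f = wordDer (sortedWord μ) f := by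
  unfold mder sortedWord
  induction List.finRange n with
  | nil => rfl
  | cons i l ih => rw [List.foldr_cons, List.flatMap_cons, wordDer_append, ih, wordDer_replicate]

lemma length_sortedWord (μ : Fin n → ℕ) : (sortedWord μ).length = mOrder μ := by
  simp [sortedWord, mOrder, List.length_flatMap, Fin.sum_univ_def]

lemma count_sortedWord (μ : Fin n → ℕ) (j : Fin n) : (sortedWord μ).count j = μ j := by
  simp [sortedWord, List.count_flatMap, List.count_replicate, Function.comp_def,
    ← Fin.sum_univ_def]

lemma pairwise_sortedWord (μ : Fin n → ℕ) : (sortedWord μ).Pairwise (· ≤ ·) := by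
  rw [sortedWord, List.pairwise_flatMap]
  refine ⟨fun i _ => by simp [List.pairwise_replicate], ?_⟩
  refine (List.pairwise_lt_finRange n).imp fun {a b} hab x hx y hy => ?_
  rw [List.eq_of_mem_replicate hx, List.eq_of_mem_replicate hy]
  exact hab.le

lemma sortedWord_count {L : List (Fin n)} (hL : L.Pairwise (· ≤ ·)) :
    sortedWord (fun i => L.count i) = L :=
  List.Perm.eq_of_pairwise (fun _ _ _ _ => le_antisymm) (pairwise_sortedWord _) hL
    (List.perm_iff_count.2 fun j => count_sortedWord _ j)

lemma ContDiff.pder {f : (Fin n → ℝ) → V} (hf : ContDiff ℝ ∞ f) (i : Fin n) :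
    ContDiff ℝ ∞ (pder i f) :=
  (hf.fderiv_right (m := ∞) (by simp)).clm_apply contDiff_const

lemma ContDiff.wordDer {f : (Fin n → ℝ) → V} (hf : ContDiff ℝ ∞ f) (L : List (Fin n)) :
    ContDiff ℝ ∞ (wordDer L f) := by
  induction L with
  | nil => exact hf
  | cons i L ih => exact ih.pder i

lemma pder_add {f g : (Fin n → ℝ) → V} (hf : ContDiff ℝ ∞ f) (hg : ContDiff ℝ ∞ g)
    (i : Fin n) : pder i (fun x => f x + g x) = fun x => pder i f x + pder i g x := by
  funext x
  simp only [pder]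
  rw [fderiv_fun_add (hf.differentiable (by simp) x) (hg.differentiable (by simp) x)]
  rfl

lemma wordDer_add {f g : (Fin n → ℝ) → V} (hf : ContDiff ℝ ∞ f) (hg : ContDiff ℝ ∞ g)
    (L : List (Fin n)) :
    wordDer L (fun x => f x + g x) = fun x => wordDer L f x + wordDer L g x := by
  induction L with
  | nil => rfl
  | cons i L ih =>
    change pder i (wordDer L _) = _
    rw [ih, pder_add (hf.wordDer L) (hg.wordDer L)]
    rfl

lemma pder_smul {φ : (Fin n → ℝ) → ℝ} {f : (Fin n → ℝ) → V} (hφ : ContDiff ℝ ∞ φ)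
    (hf : ContDiff ℝ ∞ f) (i : Fin n) :
    pder i (fun x => φ x • f x) = fun x => pder i φ x • f x + φ x • pder i f x := by
  funext x
  simp only [pder]
  rw [fderiv_fun_smul (hφ.differentiable (by simp) x) (hf.differentiable (by simp) x)]
  simp [add_comm]

lemma pder_comp_smul {f : (Fin n → ℝ) → V} (c : ℝ) (i : Fin n) :
    pder i (fun x => f (c • x)) = fun x => c • pder i f (c • x) := by
  funext x
  simp only [pder]
  rw [fderiv_comp_smul]
  rfl

lemma pder_const_smul {f : (Fin n → ℝ) → V} (hf : ContDiff ℝ ∞ f) (c : ℝ) (i : Fin n) :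
    pder i (fun x => c • f x) = fun x => c • pder i f x := by
  funext x
  simp only [pder]
  rw [fderiv_fun_const_smul (hf.differentiable (by simp) x)]
  rfl

lemma wordDer_comp_smul {f : (Fin n → ℝ) → V} (hf : ContDiff ℝ ∞ f) (c : ℝ)
    (L : List (Fin n)) :
    wordDer L (fun x => f (c • x)) = fun x => c ^ L.length • wordDer L f (c • x) := by
  induction L with
  | nil => simp [wordDer]
  | cons i L ih =>
    change pder i (wordDer L _) = _
    have hL : ContDiff ℝ ∞ fun x => wordDer L f (c • x) :=
      (hf.wordDer L).comp (contDiff_const_smul c)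
    rw [ih, pder_const_smul hL, pder_comp_smul]
    funext x
    rw [smul_smul, List.length_cons, pow_succ]
    rfl

lemma wordDer_eventuallyEq {f g : (Fin n → ℝ) → V} {x : Fin n → ℝ} (h : f =ᶠ[nhds x] g)
    (L : List (Fin n)) : wordDer L f =ᶠ[nhds x] wordDer L g := by
  induction L with
  | nil => exact h
  | cons i L ih =>
    exact (ih.fderiv (𝕜 := ℝ)).mono fun y hy => DFunLike.congr_fun hy (Pi.single i 1)

lemma wordDer_zero (L : List (Fin n)) : wordDer L (fun _ => (0 : V)) = fun _ => 0 := by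
  induction L with
  | nil => rfl
  | cons i L ih =>
    change pder i (wordDer L _) = _
    rw [ih]
    funext x
    simp [pder]

lemma HasCompactSupport.wordDer {f : (Fin n → ℝ) → V} (hf : HasCompactSupport f)
    (L : List (Fin n)) : HasCompactSupport (wordDer L f) := by
  induction L with
  | nil => exact hf
  | cons i L ih => exact ih.fderiv_apply ℝ (Pi.single i 1)

lemma wordDer_sub_const {f : (Fin n → ℝ) → V} (c : V) {L : List (Fin n)} (hL : L ≠ []) :
    wordDer L (fun x => f x - c) = wordDer L f := by
  rw [← List.dropLast_append_getLast hL, wordDer_concat, wordDer_concat]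
  congr 1
  funext x
  simp only [pder]
  rw [fderiv_sub_const]

/-- A product estimate of Leibniz type, uniform over a family of scalar factors: a factor `b`
gained with every derivative of both factors is gained with every derivative of the product. -/
lemma exists_norm_wordDer_smul_le {ι : Type*} (b : (Fin n → ℝ) → ℝ) (L : List (Fin n))
    (φ : ι → (Fin n → ℝ) → ℝ) (F : (Fin n → ℝ) → V) (h : ι → (Fin n → ℝ) → ℝ)
    (g : (Fin n → ℝ) → ℝ) (hφ : ∀ ε, ContDiff ℝ ∞ (φ ε)) (hF : ContDiff ℝ ∞ F)
    (hφb : ∀ A : List (Fin n), A.Sublist L →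
      ∃ C, ∀ ε x, ‖wordDer A (φ ε) x‖ ≤ C * (h ε x * b x ^ A.length))
    (hFb : ∀ A : List (Fin n), A.Sublist L →
      ∃ C, ∀ x, ‖wordDer A F x‖ ≤ C * (g x * b x ^ A.length)) :
    ∃ C, ∀ ε x, ‖wordDer L (fun y => φ ε y • F y) x‖ ≤ C * (h ε x * g x * b x ^ L.length) := by
  induction L using List.reverseRecOn generalizing φ F h g with
  | nil =>
    obtain ⟨C₁, h₁⟩ := hφb [] (List.Sublist.refl _)
    obtain ⟨C₂, h₂⟩ := hFb [] (List.Sublist.refl _)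
    refine ⟨C₁ * C₂, fun ε x => ?_⟩
    calc ‖φ ε x • F x‖ = ‖φ ε x‖ * ‖F x‖ := norm_smul _ _
      _ ≤ _ := mul_le_mul (h₁ ε x) (h₂ x) (norm_nonneg _) ((norm_nonneg _).trans (h₁ ε x))
      _ = _ := by simp; ring
  | append_singleton L i ih =>
    have hsub : ∀ A : List (Fin n), A.Sublist L → A.Sublist (L ++ [i]) := fun A hA =>
      hA.trans (List.sublist_append_left L [i])
    obtain ⟨C₁, h₁⟩ := ih (fun ε => pder i (φ ε)) F (fun ε x => h ε x * b x) g
      (fun ε => (hφ ε).pder i) hF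
      (fun A hA => (hφb (A ++ [i]) (hA.append_right [i])).imp fun C hC ε x => by
        rw [← wordDer_concat]
        refine (hC ε x).trans_eq ?_
        rw [List.length_append, List.length_singleton]
        ring)
      (fun A hA => hFb A (hsub A hA))
    obtain ⟨C₂, h₂⟩ := ih φ (pder i F) h (fun x => g x * b x) hφ (hF.pder i)
      (fun A hA => hφb A (hsub A hA))
      (fun A hA => (hFb (A ++ [i]) (hA.append_right [i])).imp fun C hC x => by
        rw [← wordDer_concat]
        refine (hC x).trans_eq ?_
        rw [List.length_append, List.length_singleton]
        ring)
    refine ⟨C₁ + C₂, fun ε x => ?_⟩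
    rw [wordDer_concat, pder_smul (hφ ε) hF,
      wordDer_add (f := fun y => pder i (φ ε) y • F y) (g := fun y => φ ε y • pder i F y)
        (((hφ ε).pder i).smul hF) ((hφ ε).smul (hF.pder i))]
    refine (norm_add_le _ _).trans ((add_le_add (h₁ ε x) (h₂ ε x)).trans_eq ?_)
    rw [List.length_append, List.length_singleton]
    ring

end WordDerivative

section Estimates

variable {n : ℕ}

/-- Derivatives of the rescaled functions `x ↦ χ (ε x) - 1` vanish where `‖ε x‖ < r` and gain
a factor `b` each, uniformly in `0 < ε ≤ 1`, as soon as `b` dominates `(1 + ‖x‖)⁻¹`. -/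
lemma exists_norm_wordDer_cutoff_le {r : ℝ} {χ : (Fin n → ℝ) → ℝ}
    (hχ : ContDiff ℝ ∞ χ) (hχc : HasCompactSupport χ)
    (hχ1 : ∀ x : Fin n → ℝ, ‖x‖ ≤ r → χ x = 1) {b : (Fin n → ℝ) → ℝ}
    (hb : ∀ x, 1 ≤ (1 + ‖x‖) * b x) (A : List (Fin n)) :
    ∃ C, ∀ (ε : Set.Ioc (0 : ℝ) 1) x, ‖wordDer A (fun y => χ ((ε : ℝ) • y) - 1) x‖ ≤
      C * ((if r ≤ ε * ‖x‖ then 1 else 0) * b x ^ A.length) := by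
  have hψ : ContDiff ℝ ∞ (fun y => χ y - 1) := hχ.sub contDiff_const
  have hbound : ∃ C, ∀ y, (1 + ‖y‖) ^ A.length * ‖wordDer A (fun y => χ y - 1) y‖ ≤ C := by
    rcases eq_or_ne A [] with rfl | hA
    · obtain ⟨C, hC⟩ := hχc.exists_bound_of_continuous hχ.continuous
      refine ⟨C + 1, fun y => ?_⟩
      calc _ = ‖χ y - 1‖ := by simp [wordDer]
        _ ≤ ‖χ y‖ + ‖(1 : ℝ)‖ := norm_sub_le _ _
        _ ≤ C + 1 := by simpa using hC y
    · rw [wordDer_sub_const 1 hA]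
      have hcont : Continuous fun y : Fin n → ℝ => (1 + ‖y‖) ^ A.length • wordDer A χ y :=
        ((continuous_const.add continuous_norm).pow _).smul (hχ.wordDer A).continuous
      obtain ⟨C, hC⟩ := HasCompactSupport.exists_bound_of_continuous
        ((hχc.wordDer A).smul_left (f := fun y => (1 + ‖y‖) ^ A.length)) hcont
      refine ⟨C, fun y => le_of_eq_of_le ?_ (hC y)⟩
      change _ = ‖(1 + ‖y‖) ^ A.length • wordDer A χ y‖
      rw [norm_smul, Real.norm_of_nonneg (by positivity : 0 ≤ (1 + ‖y‖) ^ A.length)]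
  obtain ⟨C, hC⟩ := hbound
  refine ⟨C, fun ⟨ε, hε0, hε1⟩ x => ?_⟩
  dsimp only
  rw [wordDer_comp_smul hψ ε A]
  have hnorm : ‖ε • x‖ = ε * ‖x‖ := by rw [norm_smul, Real.norm_of_nonneg hε0.le]
  split_ifs with hx
  · have hbx : 0 < b x := pos_of_mul_pos_right (one_pos.trans_le (hb x)) (by positivity)
    have hε : ε ≤ (1 + ‖ε • x‖) * b x := by
      calc ε ≤ ε * ((1 + ‖x‖) * b x) := le_mul_of_one_le_right hε0.le (hb x)
        _ = (ε + ε * ‖x‖) * b x := by ring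
        _ ≤ _ := by rw [hnorm]; gcongr
    rw [norm_smul, norm_pow, Real.norm_of_nonneg hε0.le, one_mul]
    calc _ ≤ ((1 + ‖ε • x‖) * b x) ^ A.length * ‖wordDer A (fun y => χ y - 1) (ε • x)‖ := by
          gcongr
      _ = (1 + ‖ε • x‖) ^ A.length * ‖wordDer A (fun y => χ y - 1) (ε • x)‖
          * b x ^ A.length := by rw [mul_pow]; ring
      _ ≤ _ := by gcongr; exact hC _
  · have hzero : (fun y => χ y - 1) =ᶠ[nhds (ε • x)] fun _ => 0 := by
      filter_upwards [(isOpen_lt continuous_norm continuous_const).mem_nhds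
        (show ‖ε • x‖ < r by rw [hnorm]; exact not_le.1 hx)] with y hy
      rw [hχ1 y (le_of_lt hy), sub_self]
    simp [(wordDer_eventuallyEq hzero A).eq_of_nhds, wordDer_zero]

lemma IsSymbol.exists_norm_wordDer_le {V : Type*} [NormedAddCommGroup V] [NormedSpace ℝ V]
    {m ρ ρ' : ℝ} {F : (Fin n → ℝ) → V} (hF : IsSymbol m ρ F) (hρ : ρ' ≤ ρ)
    {A : List (Fin n)} (hA : A.Pairwise (· ≤ ·)) :
    ∃ C, ∀ x, ‖wordDer A F x‖ ≤
      C * ((1 + ‖x‖ ^ 2) ^ (m / 2) * ((1 + ‖x‖ ^ 2) ^ (-ρ' / 2)) ^ A.length) := by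
  obtain ⟨C, hC⟩ := hF.2 fun i => A.count i
  refine ⟨C, fun x => ?_⟩
  have hs : 1 ≤ 1 + ‖x‖ ^ 2 := by nlinarith [sq_nonneg ‖x‖]
  have hs0 : 0 < 1 + ‖x‖ ^ 2 := by positivity
  have hx := hC x
  rw [mder_eq_wordDer, symWt, ← length_sortedWord, sortedWord_count hA] at hx
  have hC0 : 0 ≤ C := le_trans (by positivity) hx
  rw [← Real.rpow_mul_natCast hs0.le, ← Real.rpow_add hs0]
  calc ‖wordDer A F x‖ = (1 + ‖x‖ ^ 2) ^ ((m - ρ * A.length) / 2) *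
        ((1 + ‖x‖ ^ 2) ^ (-(m - ρ * A.length) / 2) * ‖wordDer A F x‖) := by
        rw [← mul_assoc, ← Real.rpow_add hs0, neg_div, add_neg_cancel, Real.rpow_zero, one_mul]
    _ ≤ (1 + ‖x‖ ^ 2) ^ ((m - ρ * A.length) / 2) * C := by gcongr
    _ ≤ _ := by
      rw [mul_comm]
      gcongr
      have := mul_le_mul_of_nonneg_right hρ (Nat.cast_nonneg (α := ℝ) A.length)
      linarith

lemma one_le_mul_rpow {ρ' : ℝ} (hρ' : ρ' ≤ 1) (x : Fin n → ℝ) :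
    1 ≤ (1 + ‖x‖) * (1 + ‖x‖ ^ 2) ^ (-ρ' / 2) := by
  have hs0 : 0 < 1 + ‖x‖ ^ 2 := by positivity
  have hs : 1 ≤ 1 + ‖x‖ ^ 2 := by nlinarith [sq_nonneg ‖x‖]
  calc 1 = (1 + ‖x‖ ^ 2) ^ (1 / 2 : ℝ) * (1 + ‖x‖ ^ 2) ^ (-1 / 2 : ℝ) := by
        rw [← Real.rpow_add hs0]; norm_num
    _ ≤ _ := by
      gcongr
      · rw [← Real.sqrt_eq_rpow]
        exact Real.sqrt_le_iff.2 ⟨by positivity, by nlinarith [norm_nonneg x]⟩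

end Estimates

theorem statement5 {n : ℕ} {V : Type*} [NormedAddCommGroup V] [NormedSpace ℝ V]
    [NormedSpace ℂ V] [IsScalarTower ℝ ℂ V]
    (r : ℝ) (hr : 0 < r)
    (χ : (Fin n → ℝ) → ℝ) (hχ : ContDiff ℝ (⊤ : ℕ∞) χ) (hχc : HasCompactSupport χ)
    (hχ1 : ∀ x : Fin n → ℝ, ‖x‖ ≤ r → χ x = 1)
    (m ρ : ℝ) (F : (Fin n → ℝ) → V) (hF : IsSymbol m ρ F)
    (m' ρ' : ℝ) (hm' : m < m') (hρ' : ρ' ≤ min 1 ρ) (μ : Fin n → ℕ) :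
    Tendsto (fun ε : ℝ => symNorm m' ρ' μ (fun x => χ (ε • x) • F x - F x))
      (nhdsWithin 0 (Set.Ioi 0)) (nhds 0) := by
  have hr1 : ρ' ≤ 1 := hρ'.trans (min_le_left _ _)
  have hr2 : ρ' ≤ ρ := hρ'.trans (min_le_right _ _)
  obtain ⟨C, hC⟩ := exists_norm_wordDer_smul_le (fun x => (1 + ‖x‖ ^ 2) ^ (-ρ' / 2))
    (sortedWord μ) (fun (ε : Set.Ioc (0 : ℝ) 1) y => χ ((ε : ℝ) • y) - 1) F
    (fun ε x => if r ≤ ε * ‖x‖ then 1 else 0) (fun x => (1 + ‖x‖ ^ 2) ^ (m / 2))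
    (fun ε => (hχ.comp (contDiff_const_smul (ε : ℝ))).sub contDiff_const) hF.1
    (fun A _ => exists_norm_wordDer_cutoff_le hχ hχc hχ1 (one_le_mul_rpow hr1) A)
    (fun A hA => hF.exists_norm_wordDer_le hr2 ((pairwise_sortedWord μ).sublist hA))
  have hlim : Tendsto (fun ε : ℝ => |C| * (ε / r) ^ (m' - m))
      (nhdsWithin 0 (Set.Ioi 0)) (nhds 0) := by
    have hc : ContinuousAt (fun ε : ℝ => |C| * (ε / r) ^ (m' - m)) 0 :=
      continuousAt_const.mul ((continuousAt_id.div_const r).rpow_const (Or.inr (by linarith)))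
    have ht := hc.tendsto
    rw [zero_div, Real.zero_rpow (by linarith), mul_zero] at ht
    exact ht.mono_left nhdsWithin_le_nhds
  refine squeeze_zero' (Eventually.of_forall fun ε => Real.iSup_nonneg fun x => ?_) ?_ hlim
  · unfold symWt
    positivity
  filter_upwards [Ioc_mem_nhdsGT (zero_lt_one (α := ℝ))] with ε hε
  refine ciSup_le fun x => ?_
  have hε0 : 0 < ε := hε.1
  have hs0 : 0 < 1 + ‖x‖ ^ 2 := by positivity
  have hx := hC ⟨ε, hε⟩ x
  simp only [sub_smul, one_smul] at hx
  rw [mder_eq_wordDer, symWt, ← length_sortedWord]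
  split_ifs at hx with hrx
  · have hpow : (1 + ‖x‖ ^ 2) ^ (-(m' - m) / 2) ≤ (ε / r) ^ (m' - m) := by
      have hle : (r / ε) ^ 2 ≤ 1 + ‖x‖ ^ 2 := by
        have : r / ε ≤ ‖x‖ := by rwa [div_le_iff₀' hε0]
        nlinarith [div_pos hr hε0]
      calc _ ≤ ((r / ε) ^ 2) ^ (-(m' - m) / 2) :=
            Real.rpow_le_rpow_of_nonpos (by positivity) hle (by linarith)
        _ = _ := by
          rw [← Real.rpow_natCast_mul (by positivity), ← inv_div r ε,
            Real.inv_rpow (by positivity), ← Real.rpow_neg (by positivity)]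
          congr 1
          push_cast
          ring
    calc _ ≤ (1 + ‖x‖ ^ 2) ^ (-(m' - ρ' * (sortedWord μ).length) / 2) *
          (C * (1 * (1 + ‖x‖ ^ 2) ^ (m / 2) *
            ((1 + ‖x‖ ^ 2) ^ (-ρ' / 2)) ^ (sortedWord μ).length)) := by gcongr
      _ = C * (1 + ‖x‖ ^ 2) ^ (-(m' - m) / 2) := by
        rw [← Real.rpow_mul_natCast hs0.le, one_mul, ← Real.rpow_add hs0, mul_left_comm,
          ← Real.rpow_add hs0]
        congr 2
        ring
      _ ≤ _ := by
        gcongr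
        exact le_abs_self C
  · have h0 : ‖wordDer (sortedWord μ) (fun x => χ (ε • x) • F x - F x) x‖ = 0 :=
      le_antisymm (by simpa using hx) (norm_nonneg _)
    rw [h0, mul_zero]
    positivity
end

section
/- Let V be a complex Banach space, m ∈ ℝ, ρ ∈ ℝ with −1 < ρ ≤ 1, and F ∈ S^{m,ρ}(ℝ^{2n}, V). Let q, y ∈ ℝ^n and A an invertible real n×n matrix, and let A^T be the transpose of A with respect to the pairing, i.e. ⟨Ap, x⟩ = ⟨p, A^T x⟩ for all p, x. Define F_{q,y,A}(p,x) := e^{−i⟨p,y⟩} F(Ap+q, x) and F^{q,y,A}(p,x) := e^{−i⟨q,x⟩} F(p, A^T x + y). Then F_{q,y,A} and F^{q,y,A} belong to S^{m, min(ρ,0)}(ℝ^{2n}, V), and their oscillatory integrals coincide: I(F_{q,y,A}) = I(F^{q,y,A}). -/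
open Filter MeasureTheory

def fstHalf {n : ℕ} (z : Fin (n + n) → ℝ) : Fin n → ℝ := fun i => z (Fin.castAdd n i)

def sndHalf {n : ℕ} (z : Fin (n + n) → ℝ) : Fin n → ℝ := fun i => z (Fin.natAdd n i)

noncomputable def pairM {n : ℕ} (M : Matrix (Fin n) (Fin n) ℝ) (p x : Fin n → ℝ) : ℝ :=
  ∑ i, p i * M.mulVec x i

noncomputable def phase {n : ℕ} (M : Matrix (Fin n) (Fin n) ℝ) (z : Fin (n + n) → ℝ) : ℂ :=
  Complex.exp (Complex.I * (pairM M (fstHalf z) (sndHalf z) : ℂ))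

noncomputable def cutInt {n : ℕ} {V : Type*} [NormedAddCommGroup V] [NormedSpace ℝ V]
    [NormedSpace ℂ V] [IsScalarTower ℝ ℂ V] (M : Matrix (Fin n) (Fin n) ℝ)
    (χ : (Fin (n + n) → ℝ) → ℝ) (z₀ : Fin (n + n) → ℝ) (ε : ℝ)
    (F : (Fin (n + n) → ℝ) → V) : V :=
  ((2 * Real.pi) ^ n)⁻¹ • ∫ z : Fin (n + n) → ℝ, χ (ε • (z - z₀)) • (phase M z • F z)

def IsOscInt {n : ℕ} {V : Type*} [NormedAddCommGroup V] [NormedSpace ℝ V]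
    [NormedSpace ℂ V] [IsScalarTower ℝ ℂ V] (M : Matrix (Fin n) (Fin n) ℝ)
    (F : (Fin (n + n) → ℝ) → V) (v : V) : Prop :=
  ∀ χ : (Fin (n + n) → ℝ) → ℝ, ContDiff ℝ (⊤ : ℕ∞) χ → HasCompactSupport χ →
    (∀ᶠ z in nhds (0 : Fin (n + n) → ℝ), χ z = 1) →
    ∀ z₀ : Fin (n + n) → ℝ,
      Filter.Tendsto (fun ε : ℝ => cutInt M χ z₀ ε F) (nhdsWithin 0 (Set.Ioi 0)) (nhds v)

open Classical in
noncomputable def oscInt {n : ℕ} {V : Type*} [NormedAddCommGroup V] [NormedSpace ℝ V]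
    [NormedSpace ℂ V] [IsScalarTower ℝ ℂ V] (M : Matrix (Fin n) (Fin n) ℝ)
    (F : (Fin (n + n) → ℝ) → V) : V :=
  if h : ∃ v, IsOscInt M F v then h.choose else 0

section Derivatives

variable {N : ℕ} {V : Type*} [NormedAddCommGroup V] [NormedSpace ℝ V]

theorem contDiff_pder_s13 {F : (Fin N → ℝ) → V} (hF : ContDiff ℝ (⊤ : ℕ∞) F) (i : Fin N) :
    ContDiff ℝ (⊤ : ℕ∞) (pder i F) :=
  (hF.fderiv_right (m := (⊤ : ℕ∞)) (by simp)).clm_apply contDiff_const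

theorem contDiff_foldr_pder_s13 {F : (Fin N → ℝ) → V} (hF : ContDiff ℝ (⊤ : ℕ∞) F)
    (l : List (Fin N)) : ContDiff ℝ (⊤ : ℕ∞) (l.foldr pder F) := by
  induction l with
  | nil => exact hF
  | cons i l ih => exact contDiff_pder_s13 ih i

theorem pder_comm {F : (Fin N → ℝ) → V} (hF : ContDiff ℝ (⊤ : ℕ∞) F) (i j : Fin N) :
    pder i (pder j F) = pder j (pder i F) := by
  have key : ∀ (a b : Fin N) (x : Fin N → ℝ), pder a (pder b F) x =
      fderiv ℝ (fderiv ℝ F) x (Pi.single a 1) (Pi.single b 1) := by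
    intro a b x
    have hd : DifferentiableAt ℝ (fderiv ℝ F) x :=
      ((hF.fderiv_right (m := (⊤ : ℕ∞)) (by simp)).differentiable (by simp)) x
    change fderiv ℝ (fun y => fderiv ℝ F y (Pi.single b 1)) x (Pi.single a 1) = _
    rw [fderiv_clm_apply hd (differentiableAt_const _)]
    simp
  funext x
  rw [key, key]
  refine (hF.contDiffAt.isSymmSndFDerivAt ?_).eq _ _
  simpa using WithTop.coe_le_coe.2 (le_top : (2 : ℕ∞) ≤ ⊤)

theorem foldr_pder_perm {F : (Fin N → ℝ) → V} (hF : ContDiff ℝ (⊤ : ℕ∞) F)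
    {l l' : List (Fin N)} (h : l.Perm l') : l.foldr pder F = l'.foldr pder F := by
  induction h with
  | nil => rfl
  | cons i _ ih => simp only [List.foldr_cons, ih]
  | swap i j l => exact pder_comm (contDiff_foldr_pder_s13 hF l) j i
  | trans _ _ ih₁ ih₂ => exact ih₁.trans ih₂

theorem foldr_pder_apply {F : (Fin N → ℝ) → V} (hF : ContDiff ℝ (⊤ : ℕ∞) F)
    (l : List (Fin N)) (x : Fin N → ℝ) :
    l.foldr pder F x = iteratedFDeriv ℝ l.length F x (fun j => Pi.single (l.get j) 1) := by
  induction l generalizing x with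
  | nil => simp
  | cons i l ih =>
    have hd : DifferentiableAt ℝ (iteratedFDeriv ℝ l.length F) x :=
      (hF.differentiable_iteratedFDeriv (mod_cast WithTop.coe_lt_top _)) x
    rw [List.foldr_cons, pder, funext ih]
    change _ = iteratedFDeriv ℝ (l.length + 1) F x _
    rw [iteratedFDeriv_succ_apply_left, fderiv_continuousMultilinear_apply_const_apply hd]
    rfl

/-- The list in which each index `i` occurs `μ i` times, in increasing order. -/
def multiindexList (μ : Fin N → ℕ) : List (Fin N) :=
  (List.finRange N).flatMap fun i => List.replicate (μ i) i

theorem foldr_pder_replicate (k : ℕ) (i : Fin N) (F : (Fin N → ℝ) → V) :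
    (List.replicate k i).foldr pder F = (pder i)^[k] F := by
  induction k with
  | zero => rfl
  | succ k ih => rw [List.replicate_succ, List.foldr_cons, ih, Function.iterate_succ_apply']

theorem mder_eq_foldr_pder (μ : Fin N → ℕ) (F : (Fin N → ℝ) → V) :
    mder μ F = (multiindexList μ).foldr pder F := by
  unfold mder multiindexList
  induction List.finRange N with
  | nil => rfl
  | cons i l ih =>
    rw [List.foldr_cons, ih, List.flatMap_cons, List.foldr_append, foldr_pder_replicate]

theorem length_multiindexList (μ : Fin N → ℕ) : (multiindexList μ).length = mOrder μ := by
  simp [multiindexList, mOrder, List.length_flatMap, List.sum_ofFn, ← List.ofFn_eq_map]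

theorem perm_multiindexList_count (l : List (Fin N)) :
    l.Perm (multiindexList fun i => l.count i) := by
  rw [List.perm_iff_count]
  intro a
  simp [multiindexList, List.count_flatMap, List.count_replicate, Function.comp_def,
    List.sum_ofFn, ← List.ofFn_eq_map]

theorem ContinuousMultilinearMap.opNorm_le_sum_basis {k : ℕ}
    (T : ContinuousMultilinearMap ℝ (fun _ : Fin k => Fin N → ℝ) V) :
    ‖T‖ ≤ ∑ f : Fin k → Fin N, ‖T fun j => Pi.single (f j) 1‖ := by
  refine ContinuousMultilinearMap.opNorm_le_bound (Finset.sum_nonneg fun _ _ => norm_nonneg _) ?_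
  intro v
  have hv : v = fun j => ∑ i, v j i • (Pi.single i 1 : Fin N → ℝ) := by
    funext j
    exact pi_eq_sum_univ' (v j)
  have hT : T v = ∑ f : Fin k → Fin N,
      (∏ j, v j (f j)) • T fun j => (Pi.single (f j) 1 : Fin N → ℝ) := by
    conv_lhs => rw [hv]
    rw [T.map_sum]
    exact Finset.sum_congr rfl fun f _ => T.map_smul_univ _ _
  rw [hT, Finset.sum_mul]
  refine norm_sum_le_of_le _ fun f _ => ?_
  rw [norm_smul, mul_comm, norm_prod]
  gcongr with j
  exact norm_le_pi_norm (v j) (f j)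

theorem isSymbol_iff_iteratedFDeriv (m ρ : ℝ) (F : (Fin N → ℝ) → V) :
    IsSymbol m ρ F ↔ ContDiff ℝ (⊤ : ℕ∞) F ∧ ∀ k : ℕ, ∃ C : ℝ, ∀ x,
      ‖iteratedFDeriv ℝ k F x‖ ≤ C * (1 + ‖x‖ ^ 2) ^ ((m - ρ * k) / 2) := by
  have hpos : ∀ x : Fin N → ℝ, 0 < 1 + ‖x‖ ^ 2 := fun x => by positivity
  have hwt : ∀ (μ : Fin N → ℕ) (x : Fin N → ℝ) (a C : ℝ), symWt m ρ μ x * a ≤ C ↔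
      a ≤ C * (1 + ‖x‖ ^ 2) ^ ((m - ρ * (mOrder μ : ℝ)) / 2) := by
    intro μ x a C
    rw [symWt, neg_div, Real.rpow_neg (hpos x).le, inv_mul_le_iff₀
      (Real.rpow_pos_of_pos (hpos x) _), mul_comm]
  simp only [IsSymbol, hwt]
  refine and_congr_right fun hF => ⟨fun h k => ?_, fun h μ => ?_⟩
  · choose C hC using h
    refine ⟨∑ f : Fin k → Fin N, C fun i => (List.ofFn f).count i, fun x => ?_⟩
    refine (ContinuousMultilinearMap.opNorm_le_sum_basis _).trans ?_
    rw [Finset.sum_mul]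
    refine Finset.sum_le_sum fun f _ => ?_
    have hp := perm_multiindexList_count (List.ofFn f)
    have ho : mOrder (fun i => (List.ofFn f).count i) = k := by
      rw [← length_multiindexList, ← hp.length_eq, List.length_ofFn]
    have hx := hC (fun i => (List.ofFn f).count i) x
    rw [ho, mder_eq_foldr_pder, ← foldr_pder_perm hF hp, foldr_pder_apply hF] at hx
    refine le_of_eq_of_le ?_ hx
    have aux : ∀ (l : ℕ) (hl : l = k), ‖iteratedFDeriv ℝ k F x fun j => Pi.single (f j) 1‖ =
        ‖iteratedFDeriv ℝ l F x fun j => Pi.single (f (Fin.cast hl j)) 1‖ := by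
      rintro l rfl
      rfl
    simpa [Fin.cast] using aux _ (List.length_ofFn (f := f))
  · obtain ⟨C, hC⟩ := h (mOrder μ)
    refine ⟨C, fun x => le_trans ?_ (hC x)⟩
    rw [mder_eq_foldr_pder, foldr_pder_apply hF, ← length_multiindexList]
    refine (ContinuousMultilinearMap.le_opNorm _ _).trans_eq ?_
    simp only [Pi.norm_single, norm_one, Finset.prod_const_one, mul_one]

end Derivatives

section Affine

theorem one_add_norm_sq_comp_affine_le {E : Type*} [NormedAddCommGroup E] [NormedSpace ℝ E]
    (L : E →L[ℝ] E) (c : E) :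
    ∃ D : ℝ, 0 < D ∧ ∀ x, 1 + ‖L x + c‖ ^ 2 ≤ D * (1 + ‖x‖ ^ 2) := by
  refine ⟨1 + 2 * ‖L‖ ^ 2 + 2 * ‖c‖ ^ 2, by positivity, fun x => ?_⟩
  have h : ‖L x + c‖ ≤ ‖L‖ * ‖x‖ + ‖c‖ := (norm_add_le _ _).trans (by gcongr; exact L.le_opNorm x)
  have h2 : ‖L x + c‖ ^ 2 ≤ (‖L‖ * ‖x‖ + ‖c‖) ^ 2 := by gcongr
  nlinarith [sq_nonneg (‖L‖ * ‖x‖ - ‖c‖), sq_nonneg ‖x‖, mul_nonneg (sq_nonneg ‖c‖) (sq_nonneg ‖x‖),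
    sq_nonneg ‖L‖]

theorem rpow_one_add_norm_sq_comp_affine_le {E : Type*} [NormedAddCommGroup E] [NormedSpace ℝ E]
    (L : E ≃L[ℝ] E) (c : E) (s : ℝ) :
    ∃ D : ℝ, 0 ≤ D ∧ ∀ x, (1 + ‖L x + c‖ ^ 2) ^ s ≤ D * (1 + ‖x‖ ^ 2) ^ s := by
  rcases le_total 0 s with hs | hs
  · obtain ⟨D, hD, h⟩ := one_add_norm_sq_comp_affine_le (L : E →L[ℝ] E) c
    refine ⟨D ^ s, by positivity, fun x => ?_⟩
    rw [← Real.mul_rpow hD.le (by positivity)]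
    exact Real.rpow_le_rpow (by positivity) (h x) hs
  · obtain ⟨D, hD, h⟩ := one_add_norm_sq_comp_affine_le (L.symm : E →L[ℝ] E) (-L.symm c)
    refine ⟨D⁻¹ ^ s, by positivity, fun x => ?_⟩
    rw [← Real.mul_rpow (by positivity) (by positivity)]
    refine Real.rpow_le_rpow_of_nonpos (by positivity) ?_ hs
    rw [inv_mul_le_iff₀ hD]
    simpa using h (L x + c)

theorem iteratedDeriv_cexp_const_mul_ofReal (c : ℂ) (k : ℕ) :
    iteratedDeriv k (fun t : ℝ => Complex.exp (c * t)) =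
      fun t : ℝ => c ^ k * Complex.exp (c * t) := by
  induction k with
  | zero => simp
  | succ k ih =>
    rw [iteratedDeriv_succ, ih]
    funext t
    have h : HasDerivAt (fun t : ℝ => c * (t : ℂ)) c t := by
      simpa using (Complex.ofRealCLM.hasDerivAt (x := t)).const_mul c
    rw [(h.cexp.const_mul (c ^ k)).deriv]
    ring

theorem contDiff_cexp_const_mul_ofReal (c : ℂ) :
    ContDiff ℝ (⊤ : ℕ∞) fun t : ℝ => Complex.exp (c * t) :=
  (contDiff_const.mul Complex.ofRealCLM.contDiff).cexp

theorem norm_iteratedFDeriv_cexp_neg_I_mul_le {E : Type*} [NormedAddCommGroup E]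
    [NormedSpace ℝ E] (l : E →L[ℝ] ℝ) (k : ℕ) (x : E) :
    ‖iteratedFDeriv ℝ k (fun z => Complex.exp (-Complex.I * (l z : ℂ))) x‖ ≤ ‖l‖ ^ k := by
  have h := l.iteratedFDeriv_comp_right (contDiff_cexp_const_mul_ofReal (-Complex.I)) x
    (i := k) (mod_cast le_top)
  have he : ‖iteratedFDeriv ℝ k (fun t : ℝ => Complex.exp (-Complex.I * t)) (l x)‖ = 1 := by
    rw [norm_iteratedFDeriv_eq_norm_iteratedDeriv, iteratedDeriv_cexp_const_mul_ofReal]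
    simp [Complex.norm_exp]
  change ‖iteratedFDeriv ℝ k ((fun t : ℝ => Complex.exp (-Complex.I * t)) ∘ l) x‖ ≤ _
  rw [h]
  refine (ContinuousMultilinearMap.norm_compContinuousLinearMap_le _ _).trans ?_
  rw [he, one_mul, Finset.prod_const, Finset.card_univ, Fintype.card_fin]

variable {N : ℕ} {V : Type*} [NormedAddCommGroup V] [NormedSpace ℝ V]

theorem IsSymbol.cexp_smul_comp_affine [NormedSpace ℂ V] [IsScalarTower ℝ ℂ V] {m ρ : ℝ}
    {F : (Fin N → ℝ) → V} (hF : IsSymbol m ρ F) {l : (Fin N → ℝ) → ℝ} (hl : IsLinearMap ℝ l)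
    (L : (Fin N → ℝ) ≃L[ℝ] (Fin N → ℝ)) (c : Fin N → ℝ) :
    IsSymbol m (min ρ 0) fun z => Complex.exp (-Complex.I * (l z : ℂ)) • F (L z + c) := by
  obtain ⟨l, rfl⟩ : ∃ l' : (Fin N → ℝ) →L[ℝ] ℝ, l = l' :=
    ⟨LinearMap.toContinuousLinearMap (hl.mk' l), rfl⟩
  rw [isSymbol_iff_iteratedFDeriv] at hF ⊢
  obtain ⟨hs, hb⟩ := hF
  have hse : ContDiff ℝ (⊤ : ℕ∞) fun z => Complex.exp (-Complex.I * (l z : ℂ)) :=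
    (contDiff_cexp_const_mul_ofReal (-Complex.I)).comp l.contDiff
  have hsc : ContDiff ℝ (⊤ : ℕ∞) fun z => F (z + c) := hs.comp (contDiff_id.add contDiff_const)
  have hsF : ContDiff ℝ (⊤ : ℕ∞) fun z => F (L z + c) := hsc.comp L.contDiff
  refine ⟨hse.smul hsF, fun k => ?_⟩
  choose C hC using hb
  choose D hD0 hD using fun s : ℝ => rpow_one_add_norm_sq_comp_affine_le L c s
  have hbF : ∀ (j : ℕ) (x), ‖iteratedFDeriv ℝ j (fun z => F (L z + c)) x‖ ≤
      |C j| * D ((m - ρ * j) / 2) * ‖(L : (Fin N → ℝ) →L[ℝ] (Fin N → ℝ))‖ ^ j *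
        (1 + ‖x‖ ^ 2) ^ ((m - ρ * j) / 2) := by
    intro j x
    have h := (L : (Fin N → ℝ) →L[ℝ] (Fin N → ℝ)).iteratedFDeriv_comp_right hsc x
      (i := j) (mod_cast le_top)
    change ‖iteratedFDeriv ℝ j ((fun z => F (z + c)) ∘
      (L : (Fin N → ℝ) →L[ℝ] (Fin N → ℝ))) x‖ ≤ _
    rw [h, iteratedFDeriv_comp_add_right]
    refine (ContinuousMultilinearMap.norm_compContinuousLinearMap_le _ _).trans ?_
    rw [Finset.prod_const, Finset.card_univ, Fintype.card_fin]
    calc _ ≤ (|C j| * (D ((m - ρ * j) / 2) * (1 + ‖x‖ ^ 2) ^ ((m - ρ * j) / 2))) *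
          ‖(L : (Fin N → ℝ) →L[ℝ] (Fin N → ℝ))‖ ^ j := by
            gcongr
            refine (hC j _).trans ?_
            refine mul_le_mul (le_abs_self _) (hD _ x) (by positivity) (abs_nonneg _)
      _ = _ := by ring
  refine ⟨∑ i ∈ Finset.range (k + 1), (k.choose i : ℝ) * ‖l‖ ^ i *
    (|C (k - i)| * D ((m - ρ * (k - i : ℕ)) / 2) *
      ‖(L : (Fin N → ℝ) →L[ℝ] (Fin N → ℝ))‖ ^ (k - i)), fun x => ?_⟩
  refine (norm_iteratedFDeriv_smul_le hse hsF x (mod_cast le_top)).trans ?_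
  rw [Finset.sum_mul]
  refine Finset.sum_le_sum fun i hi => ?_
  rw [mul_assoc _ _ ((1 + ‖x‖ ^ 2) ^ _)]
  have hD' := hD0 ((m - ρ * (k - i : ℕ)) / 2)
  gcongr
  · exact norm_iteratedFDeriv_cexp_neg_I_mul_le l i x
  · refine (hbF _ x).trans ?_
    have hle : min ρ 0 * (k : ℝ) ≤ ρ * ((k - i : ℕ) : ℝ) := by
      have h1 : ((k - i : ℕ) : ℝ) ≤ k := by exact_mod_cast Nat.sub_le k i
      have h2 : (0 : ℝ) ≤ ((k - i : ℕ) : ℝ) := Nat.cast_nonneg _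
      nlinarith [min_le_left ρ 0, min_le_right ρ 0]
    gcongr
    nlinarith [sq_nonneg ‖x‖]

end Affine

theorem integral_comp_continuousLinearEquiv_add {E : Type*} [NormedAddCommGroup E]
    [NormedSpace ℝ E] [MeasurableSpace E] [BorelSpace E] [FiniteDimensional ℝ E]
    {V : Type*} [NormedAddCommGroup V] [NormedSpace ℝ V] (μ : Measure E) [μ.IsAddHaarMeasure]
    (L : E ≃L[ℝ] E)
    (hL : |LinearMap.det (L : E →ₗ[ℝ] E)| = 1) (c : E) (g : E → V) :
    ∫ z, g (L z + c) ∂μ = ∫ z, g z ∂μ := by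
  have hmap : MeasurePreserving L μ μ := by
    refine ⟨L.continuous.measurable, ?_⟩
    have hd : LinearMap.det (L : E →ₗ[ℝ] E) ≠ 0 := fun h => by simp [h] at hL
    have := Measure.map_linearMap_addHaar_eq_smul_addHaar μ hd
    rw [abs_inv, hL] at this
    simpa using this
  rw [hmap.integral_comp L.toHomeomorph.measurableEmbedding fun z => g (z + c)]
  exact integral_add_right_eq_self g c

section OscillatoryIntegral

variable {n : ℕ} {V : Type*} [NormedAddCommGroup V] [NormedSpace ℝ V]
  [NormedSpace ℂ V] [IsScalarTower ℝ ℂ V]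

/-- Oscillatory integrals are invariant under affine changes of variables of determinant `±1`,
since such a change of variables turns a family of cutoffs into another one. -/
theorem IsOscInt.of_comp_affine {M : Matrix (Fin n) (Fin n) ℝ} {G H : (Fin (n + n) → ℝ) → V}
    (L : (Fin (n + n) → ℝ) ≃L[ℝ] (Fin (n + n) → ℝ))
    (hL : |LinearMap.det (L : (Fin (n + n) → ℝ) →ₗ[ℝ] (Fin (n + n) → ℝ))| = 1)
    (c : Fin (n + n) → ℝ) (hGH : ∀ z, phase M (L z + c) • G (L z + c) = phase M z • H z) {v : V}
    (hH : IsOscInt M H v) : IsOscInt M G v := by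
  intro χ hχ hχc hχ1 z₀
  have h := hH (χ ∘ L) (hχ.comp L.contDiff) (hχc.comp_homeomorph L.toHomeomorph)
    ((L.continuous.tendsto' 0 0 (map_zero L)).eventually hχ1) (L.symm (z₀ - c))
  refine h.congr fun ε => ?_
  unfold cutInt
  rw [← integral_comp_continuousLinearEquiv_add volume L hL c
    (fun z => χ (ε • (z - z₀)) • (phase M z • G z))]
  congr 2 with z
  rw [hGH, Function.comp_apply, map_smul, map_sub, L.apply_symm_apply]
  congr 3
  abel

theorem isOscInt_iff_of_comp_affine {M : Matrix (Fin n) (Fin n) ℝ}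
    {G H : (Fin (n + n) → ℝ) → V} (L : (Fin (n + n) → ℝ) ≃L[ℝ] (Fin (n + n) → ℝ))
    (hL : |LinearMap.det (L : (Fin (n + n) → ℝ) →ₗ[ℝ] (Fin (n + n) → ℝ))| = 1)
    (c : Fin (n + n) → ℝ) (hGH : ∀ z, phase M (L z + c) • G (L z + c) = phase M z • H z) (v : V) :
    IsOscInt M G v ↔ IsOscInt M H v := by
  refine ⟨IsOscInt.of_comp_affine L.symm ?_ (-L.symm c) fun z => ?_,
    IsOscInt.of_comp_affine L hL c hGH⟩
  · have h := congrArg abs (LinearEquiv.det_symm_mul_det L.toLinearEquiv)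
    change |LinearMap.det (L.symm : (Fin (n + n) → ℝ) →ₗ[ℝ] (Fin (n + n) → ℝ)) *
      LinearMap.det (L : (Fin (n + n) → ℝ) →ₗ[ℝ] (Fin (n + n) → ℝ))| = |1| at h
    rwa [abs_mul, hL, mul_one, abs_one] at h
  · simpa using (hGH (L.symm z + -L.symm c)).symm

theorem exists_continuousLinearEquiv_append_mulVec {P Q : Matrix (Fin n) (Fin n) ℝ}
    (hP : P.det ≠ 0) (hQ : Q.det ≠ 0) :
    ∃ L : (Fin (n + n) → ℝ) ≃L[ℝ] (Fin (n + n) → ℝ),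
      (∀ z, L z = Fin.append (P.mulVec (fstHalf z)) (Q.mulVec (sndHalf z))) ∧
      LinearMap.det (L : (Fin (n + n) → ℝ) →ₗ[ℝ] (Fin (n + n) → ℝ)) = P.det * Q.det := by
  set R : Matrix (Fin (n + n)) (Fin (n + n)) ℝ :=
    Matrix.reindex finSumFinEquiv finSumFinEquiv (Matrix.fromBlocks P 0 0 Q) with hR
  have hdet : LinearMap.det (Matrix.toLin' R) = P.det * Q.det := by
    rw [LinearMap.det_toLin', hR, Matrix.det_reindex_self, Matrix.det_fromBlocks_zero₂₁]
  have hne : (LinearMap.toContinuousLinearMap (Matrix.toLin' R)).det ≠ 0 :=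
    hdet.trans_ne (mul_ne_zero hP hQ)
  refine ⟨ContinuousLinearMap.toContinuousLinearEquivOfDetNeZero _ hne, fun z => ?_, hdet⟩
  rw [ContinuousLinearMap.toContinuousLinearEquivOfDetNeZero_apply]
  change R.mulVec z = _
  funext i
  refine Fin.addCases (fun i => ?_) (fun i => ?_) i <;>
    simp [-Fin.natAdd_eq_addNat, hR, Matrix.mulVec, dotProduct, Fin.sum_univ_add, fstHalf, sndHalf]

end OscillatoryIntegral

section Pairing

variable {n : ℕ} (M : Matrix (Fin n) (Fin n) ℝ)

theorem pairM_eq_dotProduct (p x : Fin n → ℝ) : pairM M p x = p ⬝ᵥ M.mulVec x := rfl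

theorem isLinearMap_pairM_fstHalf (y : Fin n → ℝ) :
    IsLinearMap ℝ fun z : Fin (n + n) → ℝ => pairM M (fstHalf z) y where
  map_add a b := add_dotProduct (fstHalf a) (fstHalf b) _
  map_smul r a := smul_dotProduct r (fstHalf a) _

theorem isLinearMap_pairM_sndHalf (q : Fin n → ℝ) :
    IsLinearMap ℝ fun z : Fin (n + n) → ℝ => pairM M q (sndHalf z) where
  map_add a b := by
    change q ⬝ᵥ M.mulVec (sndHalf a + sndHalf b) = _
    rw [Matrix.mulVec_add, dotProduct_add]
    rfl
  map_smul r a := by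
    change q ⬝ᵥ M.mulVec (r • sndHalf a) = _
    rw [Matrix.mulVec_smul, dotProduct_smul]
    rfl

variable {M}

theorem det_eq_of_pairM_mulVec (hM : |M.det| = 1) {A B : Matrix (Fin n) (Fin n) ℝ}
    (hAT : ∀ p x : Fin n → ℝ, pairM M (A.mulVec p) x = pairM M p (B.mulVec x)) :
    B.det = A.det := by
  have h : A.transpose * M = M * B := by
    refine Matrix.ext_of_mulVec_single fun i => ?_
    refine dotProduct_eq _ _ fun p => ?_
    have := hAT p (Pi.single i 1)
    rw [pairM_eq_dotProduct, pairM_eq_dotProduct] at this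
    rw [dotProduct_comm, dotProduct_comm _ p, ← Matrix.mulVec_mulVec, ← Matrix.mulVec_mulVec,
      ← this, Matrix.dotProduct_mulVec p, Matrix.vecMul_transpose]
  have hd := congrArg Matrix.det h
  rw [Matrix.det_mul, Matrix.det_mul, Matrix.det_transpose, mul_comm] at hd
  exact (mul_left_cancel₀ (fun h0 => by simp [h0] at hM) hd).symm

end Pairing

theorem append_add_append {n : ℕ} (a b c d : Fin n → ℝ) :
    Fin.append a b + Fin.append c d = Fin.append (a + c) (b + d) := by
  funext i
  refine Fin.addCases (fun i => ?_) (fun i => ?_) i <;> simp [-Fin.natAdd_eq_addNat]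

theorem fstHalf_append {n : ℕ} (a b : Fin n → ℝ) : fstHalf (Fin.append a b) = a := by
  funext i
  simp [fstHalf]

theorem sndHalf_append {n : ℕ} (a b : Fin n → ℝ) : sndHalf (Fin.append a b) = b := by
  funext i
  simp [-Fin.natAdd_eq_addNat, sndHalf]

theorem statement13 {n : ℕ} {V : Type*} [NormedAddCommGroup V] [NormedSpace ℝ V]
    [NormedSpace ℂ V] [IsScalarTower ℝ ℂ V] [CompleteSpace V]
    (M : Matrix (Fin n) (Fin n) ℝ) (hM : |M.det| = 1)
    (m ρ : ℝ) (hρ1 : -1 < ρ) (hρ2 : ρ ≤ 1)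
    (F : (Fin (n + n) → ℝ) → V) (hF : IsSymbol m ρ F)
    (q y : Fin n → ℝ) (A B : Matrix (Fin n) (Fin n) ℝ) (hA : IsUnit A.det)
    (hAT : ∀ p x : Fin n → ℝ, pairM M (A.mulVec p) x = pairM M p (B.mulVec x)) :
    IsSymbol m (min ρ 0) (fun z : Fin (n + n) → ℝ =>
      Complex.exp (-Complex.I * (pairM M (fstHalf z) y : ℂ)) •
        F (Fin.append (A.mulVec (fstHalf z) + q) (sndHalf z))) ∧
    IsSymbol m (min ρ 0) (fun z : Fin (n + n) → ℝ =>
      Complex.exp (-Complex.I * (pairM M q (sndHalf z) : ℂ)) •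
        F (Fin.append (fstHalf z) (B.mulVec (sndHalf z) + y))) ∧
    oscInt M (fun z : Fin (n + n) → ℝ =>
        Complex.exp (-Complex.I * (pairM M (fstHalf z) y : ℂ)) •
          F (Fin.append (A.mulVec (fstHalf z) + q) (sndHalf z))) =
      oscInt M (fun z : Fin (n + n) → ℝ =>
        Complex.exp (-Complex.I * (pairM M q (sndHalf z) : ℂ)) •
          F (Fin.append (fstHalf z) (B.mulVec (sndHalf z) + y))) := by
  have hA0 : A.det ≠ 0 := hA.ne_zero
  have hBA : B.det = A.det := det_eq_of_pairM_mulVec hM hAT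
  have hB0 : B.det ≠ 0 := hBA.trans_ne hA0
  refine ⟨?_, ?_, ?_⟩
  · obtain ⟨L, hL, -⟩ := exists_continuousLinearEquiv_append_mulVec (Q := 1) hA0 (by simp)
    have h := hF.cexp_smul_comp_affine (isLinearMap_pairM_fstHalf M y) L (Fin.append q 0)
    simpa only [hL, append_add_append, Matrix.one_mulVec, add_zero] using h
  · obtain ⟨L, hL, -⟩ := exists_continuousLinearEquiv_append_mulVec (P := 1) (by simp) hB0
    have h := hF.cexp_smul_comp_affine (isLinearMap_pairM_sndHalf M q) L (Fin.append 0 y)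
    simpa only [hL, append_add_append, Matrix.one_mulVec, add_zero] using h
  · have hAi : A⁻¹.det = A.det⁻¹ := by rw [Matrix.det_nonsing_inv, Ring.inverse_eq_inv']
    obtain ⟨L, hL, hd⟩ := exists_continuousLinearEquiv_append_mulVec (P := A⁻¹) (Q := B)
      (hAi.trans_ne (inv_ne_zero hA0)) hB0
    rw [hAi, hBA, inv_mul_cancel₀ hA0] at hd
    have hiff := isOscInt_iff_of_comp_affine (M := M)
      (G := fun z : Fin (n + n) → ℝ => Complex.exp (-Complex.I * (pairM M (fstHalf z) y : ℂ)) •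
        F (Fin.append (A.mulVec (fstHalf z) + q) (sndHalf z)))
      (H := fun z : Fin (n + n) → ℝ => Complex.exp (-Complex.I * (pairM M q (sndHalf z) : ℂ)) •
        F (Fin.append (fstHalf z) (B.mulVec (sndHalf z) + y)))
      L (by rw [hd, abs_one]) (Fin.append (-A⁻¹.mulVec q) y) fun z => by
        have hAc : A.mulVec (A⁻¹.mulVec (fstHalf z) + -A⁻¹.mulVec q) = fstHalf z - q := by
          rw [← sub_eq_add_neg, ← Matrix.mulVec_sub, Matrix.mulVec_mulVec,
            Matrix.mul_nonsing_inv _ hA, Matrix.one_mulVec]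
        have hpair : pairM M (A⁻¹.mulVec (fstHalf z) + -A⁻¹.mulVec q) (B.mulVec (sndHalf z) + y) =
            pairM M (fstHalf z) (sndHalf z) - pairM M q (sndHalf z) +
              pairM M (A⁻¹.mulVec (fstHalf z) + -A⁻¹.mulVec q) y := by
          have h := hAT (A⁻¹.mulVec (fstHalf z) + -A⁻¹.mulVec q) (sndHalf z)
          rw [hAc] at h
          simp only [pairM_eq_dotProduct] at h ⊢
          rw [Matrix.mulVec_add, dotProduct_add, ← h, sub_dotProduct]
        simp only [hL, append_add_append, phase, fstHalf_append, sndHalf_append, hAc,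
          sub_add_cancel, smul_smul, ← Complex.exp_add]
        rw [hpair]
        congr 2
        push_cast
        ring
    unfold oscInt
    rw [show IsOscInt M _ = IsOscInt M _ from funext fun v => propext (hiff v)]
end
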